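/- Let U ⊆ ℝⁿ be open, λ ∈ (0,1] and σ > 0. Let Λ_ε ⊆ U be relatively closed in U and let w_ε : U → ℝ be continuous with w_ε ≥ −σ² in U, w_ε ≤ 0 on Λ_ε, and Δw_ε ≥ λ weakly in U ∖ Λ_ε. Let w₀ : U → ℝ be continuous with w₀ ≥ 0 in U, set Λ₀ := {x ∈ U : w₀(x) = 0} and Γ₀ := ∂Λ₀ ∩ U, and assume: (sandwich) w₀ − σ² ≤ w_ε ≤ w₀ in U; (non-degeneracy of w₀) there is c₀ > 0 such that sup over B_r(x) of w₀ is ≥ c₀ r² whenever x ∈ Γ₀ and cl(B_r(x)) ⊆ U; (positive density of Λ₀) there is c₂ ∈ (0,1/2) such that for every x ∈ Λ₀ and r > 0 with B_r(x) ⊆ U there exists y ∈ Λ₀ ∩ B_r(x) with cl(B_{c₂ r}(y)) ⊆ Λ₀ ∩ B_r(x); (gradient bound) w₀ is differentiable in U with |∇w₀(y)| ≤ M dist(y, Λ₀) for all y ∈ U. Let L := 4(2n/λ)^{1/2}σ, let Λ̃_ε be the union of all closed cubes L(k + [0,1]ⁿ), k ∈ ℤⁿ, intersecting Λ_ε, and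 Γ̃_ε := ∂Λ̃_ε ∩ U. Then there exists C > 0 depending only on n, λ, c₀, c₂ and M such that every x ∈ Γ₀ with Γ̃_ε ≠ ∅ and cl(B_{dist(x,Γ̃_ε) + √n·L}(x)) ⊆ U satisfies dist(x, Γ̃_ε) ≤ C σ. -/

import Mathlib

open MeasureTheory Metric Set

/-- The (pointwise) Laplacian of a smooth `f : ℝⁿ → ℝ`. -/
noncomputable def lapl (n : ℕ) (f : EuclideanSpace ℝ (Fin n) → ℝ)
    (x : EuclideanSpace ℝ (Fin n)) : ℝ :=
  ∑ i : Fin n, fderiv ℝ (fun y => fderiv ℝ f y (EuclideanSpace.single i 1)) x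
    (EuclideanSpace.single i 1)

/-- `Δw ≥ c` weakly in `V`. -/
def LapGeWeak (n : ℕ) (V : Set (EuclideanSpace ℝ (Fin n)))
    (w : EuclideanSpace ℝ (Fin n) → ℝ) (c : ℝ) : Prop :=
  ∀ φ : EuclideanSpace ℝ (Fin n) → ℝ, ContDiff ℝ (⊤ : ℕ∞) φ → HasCompactSupport φ →
    tsupport φ ⊆ V → (∀ x, 0 ≤ φ x) →
    c * ∫ x in V, φ x ≤ ∫ x in V, w x * lapl n φ x

/-- The closed lattice cube `L(k + [0,1]ⁿ)` for `k ∈ ℤⁿ`. -/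
def latticeCube (n : ℕ) (L : ℝ) (k : Fin n → ℤ) : Set (EuclideanSpace ℝ (Fin n)) :=
  {x | ∀ i, L * (k i : ℝ) ≤ x i ∧ x i ≤ L * (k i : ℝ) + L}

/-- The bulk set: the union of all closed lattice cubes of side `L` meeting `Λ`. -/
def bulkSet (n : ℕ) (L : ℝ) (Λ : Set (EuclideanSpace ℝ (Fin n))) :
    Set (EuclideanSpace ℝ (Fin n)) :=
  ⋃ (k : Fin n → ℤ) (_ : (latticeCube n L k ∩ Λ).Nonempty), latticeCube n L k

section Laplacian

variable {n : ℕ} {f : EuclideanSpace ℝ (Fin n) → ℝ}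

theorem lapl_comp_smul_sub (f : EuclideanSpace ℝ (Fin n) → ℝ) (c : ℝ)
    (y x : EuclideanSpace ℝ (Fin n)) :
    lapl n (fun z => f (c • (z - y))) x = c ^ 2 * lapl n f (c • (x - y)) := by
  have key : ∀ (g : EuclideanSpace ℝ (Fin n) → ℝ) (z : EuclideanSpace ℝ (Fin n)),
      fderiv ℝ (fun z => g (c • (z - y))) z = c • fderiv ℝ g (c • (z - y)) := by
    intro g z
    rw [fderiv_comp_sub (f := fun z => g (c • z)) y, fderiv_comp_smul]
  unfold lapl
  rw [Finset.mul_sum]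
  refine Finset.sum_congr rfl fun i _ => ?_
  simp only [key, smul_apply, smul_eq_mul]
  have h := key (fun z => c • fderiv ℝ f z (EuclideanSpace.single i 1)) x
  simp only [smul_eq_mul] at h
  rw [h]
  have h2 : fderiv ℝ (fun z => c * fderiv ℝ f z (EuclideanSpace.single i 1)) (c • (x - y))
      = c • fderiv ℝ (fun z => fderiv ℝ f z (EuclideanSpace.single i 1)) (c • (x - y)) :=
    congrFun (fderiv_const_smul_field
      (f := fun z => fderiv ℝ f z (EuclideanSpace.single i 1)) c) _
  rw [h2]
  simp only [smul_apply, smul_eq_mul]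
  ring

theorem lapl_eq_zero_of_notMem_tsupport {x : EuclideanSpace ℝ (Fin n)} (hx : x ∉ tsupport f) :
    lapl n f x = 0 := by
  have h0 : f =ᶠ[nhds x] fun _ => 0 := notMem_tsupport_iff_eventuallyEq.mp hx
  refine Finset.sum_eq_zero fun i _ => ?_
  have h1 : (fun y => fderiv ℝ f y (EuclideanSpace.single i 1)) =ᶠ[nhds x] fun _ => 0 := by
    filter_upwards [h0.fderiv (𝕜 := ℝ)] with y hy
    simp [hy]
  simp [h1.fderiv_eq]

theorem continuous_lapl (hf : ContDiff ℝ (⊤ : ℕ∞) f) : Continuous (lapl n f) := by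
  refine continuous_finsetSum _ fun i _ => ?_
  have h1 : ContDiff ℝ (⊤ : ℕ∞) fun y => fderiv ℝ f y (EuclideanSpace.single i 1) :=
    (hf.fderiv_right (m := (⊤ : ℕ∞)) (by simp)).clm_apply contDiff_const
  exact (h1.continuous_fderiv (by simp)).clm_apply continuous_const

theorem integrable_lapl (hf : ContDiff ℝ (⊤ : ℕ∞) f) (hc : HasCompactSupport f) :
    Integrable (lapl n f) := by
  refine (continuous_lapl hf).integrable_of_hasCompactSupport ?_
  exact hc.of_isClosed_subset (isClosed_tsupport _)
    (closure_minimal (fun x hx => by_contra fun h => hx (lapl_eq_zero_of_notMem_tsupport h))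
      (isClosed_tsupport f))

end Laplacian

/-- Rescaled bump functions: the integral of `|Δφ|` is controlled by `R⁻² ∫ φ`. -/
theorem exists_scaled_bump (n : ℕ) : ∃ K : ℝ, 0 ≤ K ∧
    ∀ (y : EuclideanSpace ℝ (Fin n)) (R : ℝ), 0 < R →
      ∃ φ : EuclideanSpace ℝ (Fin n) → ℝ, ContDiff ℝ (⊤ : ℕ∞) φ ∧ HasCompactSupport φ ∧
        tsupport φ ⊆ closedBall y R ∧ (∀ x, 0 ≤ φ x) ∧ 0 < ∫ x, φ x ∧
        R ^ 2 * ∫ x, |lapl n φ x| ≤ K * ∫ x, φ x := by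
  let η : ContDiffBump (0 : EuclideanSpace ℝ (Fin n)) := ⟨1 / 2, 1, by norm_num, by norm_num⟩
  have hA : 0 < ∫ x, η x := η.integral_pos
  have hB : 0 ≤ ∫ x, |lapl n η x| := integral_nonneg fun _ => abs_nonneg _
  refine ⟨(∫ x, |lapl n η x|) / ∫ x, η x, by positivity, fun y R hR => ?_⟩
  have hscale : ∀ g : EuclideanSpace ℝ (Fin n) → ℝ,
      ∫ x, g (R⁻¹ • (x - y)) = |(R⁻¹ ^ n)⁻¹| * ∫ x, g x := by
    intro g
    rw [integral_sub_right_eq_self (fun x => g (R⁻¹ • x)) y, Measure.integral_comp_smul]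
    simp
  have hts : tsupport (fun z => η (R⁻¹ • (z - y))) ⊆ closedBall y R := by
    refine closure_minimal (fun z hz => ?_) isClosed_closedBall
    have hz' : R⁻¹ • (z - y) ∈ Function.support η := hz
    rw [η.support_eq, mem_ball_zero_iff, norm_smul, norm_inv, Real.norm_of_nonneg hR.le,
      inv_mul_lt_iff₀ hR] at hz'
    rw [mem_closedBall, dist_eq_norm]
    simpa [η] using hz'.le
  have hpos : 0 < |(R⁻¹ ^ n)⁻¹| := by positivity
  refine ⟨fun z => η (R⁻¹ • (z - y)), ?_, ?_, hts, fun _ => η.nonneg, ?_, ?_⟩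
  · exact η.contDiff.comp ((contDiff_id.sub contDiff_const).const_smul R⁻¹)
  · exact (isCompact_closedBall y R).of_isClosed_subset (isClosed_tsupport _) hts
  · rw [hscale]
    positivity
  · simp only [lapl_comp_smul_sub, abs_mul, abs_pow, abs_inv, abs_of_pos hR]
    rw [integral_const_mul, hscale (fun x => |lapl n η x|), hscale]
    refine le_of_eq ?_
    field_simp

/-- If `-s ≤ w ≤ 0` and `Δw ≥ c` weakly on a ball of radius `R`, then `R² c ≤ C(n) s`. -/
theorem exists_sq_mul_le_of_lapGeWeak (n : ℕ) : ∃ K : ℝ, 0 ≤ K ∧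
    ∀ (V : Set (EuclideanSpace ℝ (Fin n))) (w : EuclideanSpace ℝ (Fin n) → ℝ) (c s : ℝ),
      LapGeWeak n V w c → ∀ (y : EuclideanSpace ℝ (Fin n)) (R : ℝ), 0 < R →
        closedBall y R ⊆ V → (∀ x ∈ closedBall y R, |w x| ≤ s) → c * R ^ 2 ≤ K * s := by
  obtain ⟨K, hK, h⟩ := exists_scaled_bump n
  refine ⟨K, hK, fun V w c s hw y R hR hV hs => ?_⟩
  obtain ⟨φ, hφ, hc, hts, h0, hpos, hle⟩ := h y R hR
  have hs0 : 0 ≤ s := (abs_nonneg _).trans (hs y (mem_closedBall_self hR.le))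
  have h1 := hw φ hφ hc (hts.trans hV) h0
  rw [setIntegral_eq_integral_of_forall_compl_eq_zero
    fun x hx => image_eq_zero_of_notMem_tsupport fun hx' => hx (hV (hts hx')),
    setIntegral_eq_integral_of_forall_compl_eq_zero fun x hx => by
      rw [lapl_eq_zero_of_notMem_tsupport fun hx' => hx (hV (hts hx')), mul_zero]] at h1
  have h2 : ‖∫ x, w x * lapl n φ x‖ ≤ ∫ x, s * |lapl n φ x| := by
    refine norm_integral_le_of_norm_le ((integrable_lapl hφ hc).abs.const_mul s)
      (.of_forall fun x => ?_)
    rw [Real.norm_eq_abs, abs_mul]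
    by_cases hx : x ∈ tsupport φ
    · exact mul_le_mul_of_nonneg_right (hs x (hts hx)) (abs_nonneg _)
    · simp [lapl_eq_zero_of_notMem_tsupport hx]
  rw [integral_const_mul] at h2
  have h3 : c * ∫ x, φ x ≤ s * ∫ x, |lapl n φ x| := h1.trans ((le_abs_self _).trans h2)
  refine le_of_mul_le_mul_right ?_ hpos
  calc c * R ^ 2 * ∫ x, φ x = R ^ 2 * (c * ∫ x, φ x) := by ring
    _ ≤ R ^ 2 * (s * ∫ x, |lapl n φ x|) := by gcongr
    _ = s * (R ^ 2 * ∫ x, |lapl n φ x|) := by ring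
    _ ≤ s * (K * ∫ x, φ x) := by gcongr
    _ = K * s * ∫ x, φ x := by ring

theorem IsPreconnected.subset_or_subset_compl_of_disjoint_frontier {X : Type*}
    [TopologicalSpace X] {s t : Set X} (hs : IsPreconnected s) (h : Disjoint s (frontier t)) :
    s ⊆ t ∨ s ⊆ tᶜ := by
  by_contra! hcon
  obtain ⟨⟨a, has, hat⟩, b, hbs, hbt⟩ := hcon.imp not_subset.mp not_subset.mp
  have hcases : ∀ x ∈ s, x ∈ interior t ∨ x ∈ (closure t)ᶜ := fun x hx => by
    by_contra! hx'
    exact disjoint_left.mp h hx ⟨not_not.mp hx'.2, hx'.1⟩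
  obtain ⟨z, -, hz1, hz2⟩ := hs _ _ isOpen_interior isClosed_closure.isOpen_compl hcases
    ⟨b, hbs, (hcases b hbs).resolve_right fun hb => hb (subset_closure (not_not.mp hbt))⟩
    ⟨a, has, (hcases a has).resolve_left fun ha => hat (interior_subset ha)⟩
  exact hz2 (interior_subset_closure hz1)

theorem dist_le_of_mem_latticeCube {n : ℕ} {L : ℝ} (hL : 0 ≤ L) {k : Fin n → ℤ}
    {x y : EuclideanSpace ℝ (Fin n)} (hx : x ∈ latticeCube n L k) (hy : y ∈ latticeCube n L k) :
    dist x y ≤ Real.sqrt n * L := by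
  rw [EuclideanSpace.dist_eq]
  refine Real.sqrt_le_iff.mpr ⟨by positivity, ?_⟩
  calc ∑ i, dist (x i) (y i) ^ 2 ≤ ∑ _i : Fin n, L ^ 2 := by
        refine Finset.sum_le_sum fun i _ => pow_le_pow_left₀ dist_nonneg ?_ 2
        rw [Real.dist_eq, abs_le]
        constructor <;> linarith [(hx i).1, (hx i).2, (hy i).1, (hy i).2]
    _ = (Real.sqrt n * L) ^ 2 := by
        rw [mul_pow, Real.sq_sqrt (Nat.cast_nonneg n)]
        simp

theorem subset_bulkSet {n : ℕ} {L : ℝ} (hL : 0 < n → 0 < L)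
    (Λ : Set (EuclideanSpace ℝ (Fin n))) : Λ ⊆ bulkSet n L Λ := by
  intro x hx
  have hmem : x ∈ latticeCube n L fun i => ⌊x i / L⌋ := fun i => by
    have hL' := hL i.pos
    have h1 := (le_div_iff₀ hL').mp (Int.floor_le (x i / L))
    have h2 := (div_lt_iff₀ hL').mp (Int.lt_floor_add_one (x i / L))
    constructor <;> linarith
  exact mem_iUnion₂.mpr ⟨_, ⟨x, hmem, hx⟩, hmem⟩

theorem exists_mem_dist_le_of_mem_bulkSet {n : ℕ} {L : ℝ} (hL : 0 ≤ L)
    {Λ : Set (EuclideanSpace ℝ (Fin n))} {x : EuclideanSpace ℝ (Fin n)}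
    (hx : x ∈ bulkSet n L Λ) : ∃ z ∈ Λ, dist x z ≤ Real.sqrt n * L := by
  obtain ⟨k, ⟨z, hzk, hz⟩, hxk⟩ := mem_iUnion₂.mp hx
  exact ⟨z, hz, dist_le_of_mem_latticeCube hL hxk hzk⟩

/-- A function whose gradient is bounded by `M dist(·, Λ)` is Lipschitz with constant `M ρ` on
balls of radius `ρ` centred on `Λ`. -/
theorem abs_sub_le_of_norm_gradient_le_infDist {E : Type*} [NormedAddCommGroup E]
    [InnerProductSpace ℝ E] [CompleteSpace E] {U Λ : Set E} {w : E → ℝ} {M ρ : ℝ} (hM : 0 ≤ M)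
    (hU : IsOpen U) (hd : DifferentiableOn ℝ w U)
    (hg : ∀ y ∈ U, ‖gradient w y‖ ≤ M * infDist y Λ) {x y z : E} (hx : x ∈ Λ)
    (hxU : closedBall x ρ ⊆ U) (hy : y ∈ closedBall x ρ) (hz : z ∈ closedBall x ρ) :
    |w y - w z| ≤ M * ρ * dist y z := by
  rw [← Real.norm_eq_abs, dist_eq_norm]
  refine (convex_closedBall x ρ).norm_image_sub_le_of_norm_fderiv_le
    (fun p hp => hd.differentiableAt (hU.mem_nhds (hxU hp))) (fun p hp => ?_) hz hy
  calc ‖fderiv ℝ w p‖ = ‖gradient w p‖ := by simp [gradient]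
    _ ≤ M * infDist p Λ := hg p (hxU hp)
    _ ≤ M * ρ := by
      gcongr
      exact (infDist_le_dist_of_mem hx).trans hp

/-- **Proposition 4.3:** every point of the free boundary `Γ₀ = ∂{w₀ = 0} ∩ U` is
within distance `Cσ` of the bulk free boundary `Γ̃_ε`, with `C = C(n, λ, c₀, c₂, M)`,
assuming the sandwich estimate, quadratic non-degeneracy of `w₀` at `Γ₀`, positive
density of `Λ₀ = {w₀ = 0}`, and the gradient bound `|∇w₀| ≤ M dist(·, Λ₀)`. -/
theorem fb_close_to_bulk_fb (n : ℕ) (lam c₀ c₂ M : ℝ) (hlam : lam ∈ Set.Ioc (0:ℝ) 1)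
    (hc₀ : 0 < c₀) (hc₂ : c₂ ∈ Set.Ioo (0:ℝ) (1/2)) (hM : 0 < M) :
    ∃ C > 0, ∀ U : Set (EuclideanSpace ℝ (Fin n)), IsOpen U →
      ∀ σ : ℝ, 0 < σ →
      ∀ Λε : Set (EuclideanSpace ℝ (Fin n)), Λε ⊆ U → closure Λε ∩ U ⊆ Λε →
      ∀ wε : EuclideanSpace ℝ (Fin n) → ℝ, ContinuousOn wε U →
        (∀ x ∈ U, -σ ^ 2 ≤ wε x) → (∀ x ∈ Λε, wε x ≤ 0) →
        LapGeWeak n (U \ Λε) wε lam →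
      ∀ w₀ : EuclideanSpace ℝ (Fin n) → ℝ, ContinuousOn w₀ U →
        (∀ x ∈ U, 0 ≤ w₀ x) →
        (∀ x ∈ U, w₀ x - σ ^ 2 ≤ wε x ∧ wε x ≤ w₀ x) →
        (∀ x ∈ frontier {y ∈ U | w₀ y = 0} ∩ U, ∀ r : ℝ, 0 < r →
          closedBall x r ⊆ U → c₀ * r ^ 2 ≤ sSup (w₀ '' ball x r)) →
        (∀ x ∈ {y ∈ U | w₀ y = 0}, ∀ r : ℝ, 0 < r → ball x r ⊆ U →
          ∃ y ∈ {y ∈ U | w₀ y = 0} ∩ ball x r,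
            closedBall y (c₂ * r) ⊆ {y ∈ U | w₀ y = 0} ∩ ball x r) →
        DifferentiableOn ℝ w₀ U →
        (∀ y ∈ U, ‖gradient w₀ y‖ ≤ M * Metric.infDist y {y ∈ U | w₀ y = 0}) →
      ∀ x ∈ frontier {y ∈ U | w₀ y = 0} ∩ U,
        (frontier (bulkSet n (4 * Real.sqrt (2 * n / lam) * σ) Λε) ∩ U).Nonempty →
        closedBall x
          (Metric.infDist x
              (frontier (bulkSet n (4 * Real.sqrt (2 * n / lam) * σ) Λε) ∩ U) +
            Real.sqrt n * (4 * Real.sqrt (2 * n / lam) * σ)) ⊆ U →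
        Metric.infDist x
            (frontier (bulkSet n (4 * Real.sqrt (2 * n / lam) * σ) Λε) ∩ U) ≤
          C * σ := by
  obtain ⟨hlam0, -⟩ := hlam
  obtain ⟨hc₂0, -⟩ := hc₂
  obtain ⟨K, hK, hKle⟩ := exists_sq_mul_le_of_lapGeWeak n
  set k : ℝ := Real.sqrt n * (4 * Real.sqrt (2 * n / lam)) with hk
  have hk0 : 0 ≤ k := by positivity
  refine ⟨1 + (1 + M * k + M * k ^ 2) / c₀ + Real.sqrt (K / lam) / c₂, by positivity, ?_⟩
  intro U hU σ hσ Λε hΛU _ wε _ hwlow hwΛ hweak w₀ hw₀c _ hsand hnondeg hdens hdiff hgrad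
    x hx _ hball
  set L := 4 * Real.sqrt (2 * n / lam) * σ with hLdef
  have hL0 : 0 ≤ L := by positivity
  have hLpos : 0 < n → 0 < L := fun hn => by positivity
  have hkL : Real.sqrt n * L = k * σ := by rw [hLdef, hk]; ring
  rw [hkL] at hball
  set d := infDist x (frontier (bulkSet n L Λε) ∩ U) with hd
  have hd0 : 0 ≤ d := infDist_nonneg
  rcases hd0.eq_or_lt with hd0' | hdpos
  · rw [← hd0']; positivity
  have hballU : closedBall x d ⊆ U :=
    (closedBall_subset_closedBall (by nlinarith)).trans hball
  have hxΛ : x ∈ {y ∈ U | w₀ y = 0} := by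
    refine ⟨hx.2, ?_⟩
    have hmem : x ∈ closure {y ∈ U | w₀ y = 0} := frontier_subset_closure hx.1
    have hcx : ContinuousWithinAt w₀ {y ∈ U | w₀ y = 0} x :=
      (hw₀c x hx.2).mono fun y hy => hy.1
    have := hcx.mem_closure hmem (t := {0}) fun y hy => hy.2
    simpa using this
  have hdisj : Disjoint (ball x d) (frontier (bulkSet n L Λε)) := disjoint_left.mpr fun z hz hzf =>
    (mem_ball'.mp hz).not_ge (infDist_le_dist_of_mem ⟨hzf, hballU (ball_subset_closedBall hz)⟩)
  rcases (convex_ball x d).isPreconnected.subset_or_subset_compl_of_disjoint_frontier hdisj with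
    hin | hout
  · have hest : c₀ * d ^ 2 ≤ σ ^ 2 + M * (d + k * σ) * (k * σ) := by
      refine (hnondeg x hx d hdpos hballU).trans
        (csSup_le ((nonempty_ball.mpr hdpos).image _) ?_)
      rintro _ ⟨y, hy, rfl⟩
      obtain ⟨z, hz, hyz⟩ := exists_mem_dist_le_of_mem_bulkSet hL0 (hin hy)
      rw [hkL] at hyz
      have hyx : dist y x < d := hy
      have hkσ : 0 ≤ k * σ := by positivity
      have hlip := abs_sub_le_of_norm_gradient_le_infDist hM.le hU hdiff hgrad hxΛ hball
        (y := y) (z := z) (mem_closedBall.mpr (by linarith))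
        (mem_closedBall.mpr (by linarith [dist_triangle_left z x y]))
      have h1 := (abs_le.mp hlip).2
      have h2 : M * (d + k * σ) * dist y z ≤ M * (d + k * σ) * (k * σ) := by gcongr
      linarith [(hsand z (hΛU hz)).1, hwΛ z hz]
    by_contra! hcon
    have hA : 0 ≤ (1 + M * k + M * k ^ 2) / c₀ := by positivity
    have hB : 0 ≤ Real.sqrt (K / lam) / c₂ := by positivity
    have hdσ : σ < d := by nlinarith
    have hdA : (1 + M * k + M * k ^ 2) / c₀ * σ < d := by nlinarith
    rw [div_mul_eq_mul_div, div_lt_iff₀ hc₀] at hdA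
    have h1 : σ ^ 2 ≤ d * σ := by nlinarith
    have h2 : M * k ^ 2 * σ ^ 2 ≤ M * k ^ 2 * (d * σ) := by gcongr
    nlinarith [mul_lt_mul_of_pos_left hdA hdpos]
  · obtain ⟨y, -, hyball⟩ := hdens x hxΛ d hdpos (ball_subset_closedBall.trans hballU)
    have hR : 0 < c₂ * d := by positivity
    have hest : lam * (c₂ * d) ^ 2 ≤ K * σ ^ 2 := by
      refine hKle _ _ _ _ hweak y (c₂ * d) hR
        (fun z hz => ⟨(hyball hz).1.1, fun hzΛ =>
          hout (hyball hz).2 (subset_bulkSet hLpos Λε hzΛ)⟩) fun z hz => ?_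
      obtain ⟨hzU, hz0⟩ := (hyball hz).1
      have := (hsand z hzU).2
      exact abs_le.mpr ⟨by linarith [hwlow z hzU], by nlinarith [sq_nonneg σ]⟩
    have h1 : c₂ * d ≤ Real.sqrt (K / lam) * σ := by
      refine (sq_le_sq₀ hR.le (by positivity)).mp ?_
      rw [mul_pow _ σ, Real.sq_sqrt (by positivity), div_mul_eq_mul_div, le_div_iff₀ hlam0]
      linarith
    have h2 : d ≤ Real.sqrt (K / lam) / c₂ * σ := by
      rw [div_mul_eq_mul_div, le_div_iff₀ hc₂0]
      linarith
    have hA : 0 ≤ (1 + M * k + M * k ^ 2) / c₀ := by positivity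
    nlinarith
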